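/- Let 0 < p ≤ 1. There exists a constant c_p > 0, depending only on p and λ = sup_k m_k, such that for every martingale f ∈ H_p, Σ_{k=1}^∞ |f̂(k)|^p / k^{2−p} ≤ c_p · ‖f‖_{H_p}^p. -/

import Mathlib

open MeasureTheory Complex Finset
open scoped BigOperators ENNReal NNReal

noncomputable section

instance (n : ℕ) : MeasurableSpace (ZMod n) := ⊤

/-- The Vilenkin group determined by the generating sequence `m`. -/
abbrev Gm (m : ℕ → ℕ) : Type := ∀ _k : ℕ, ZMod (m _k)

namespace Vilenkin

variable (m : ℕ → ℕ)

/-- The generalized powers `M_0 = 1`, `M_{k+1} = m_k · M_k`. -/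
def M : ℕ → ℕ
  | 0 => 1
  | k + 1 => m k * M k

/-- The `j`-th digit `n_j` of `n` in the generalized number system based on `m`. -/
def digit (n j : ℕ) : ℕ := n / M m j % m j

/-- `|n|`, the index of the highest nonzero digit of `n`. -/
def hi (n : ℕ) : ℕ := Nat.findGreatest (fun j => digit m n j ≠ 0) n

/-- `⟨n⟩`, the index of the lowest nonzero digit of `n`. -/
def lo (n : ℕ) : ℕ := sInf {j | digit m n j ≠ 0}

/-- The generalized Rademacher functions `r_k(x) = exp(2πi x_k / m_k)`. -/
def rad (k : ℕ) (x : Gm m) : ℂ :=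
  Complex.exp (2 * Real.pi * Complex.I * ((x k).val : ℂ) / (m k : ℂ))

/-- The Vilenkin functions `ψ_n = ∏_k r_k^{n_k}`. -/
def vil (n : ℕ) (x : Gm m) : ℂ :=
  ∏ k ∈ Finset.range (n + 1), rad m k x ^ digit m n k

/-- The Dirichlet kernels `D_n = ∑_{k=0}^{n-1} ψ_k`. -/
def D (n : ℕ) (x : Gm m) : ℂ := ∑ k ∈ Finset.range n, vil m k x

/-- The Fejér kernels `K_n = (1/n) ∑_{k=1}^{n} D_k`. -/
def K (n : ℕ) (x : Gm m) : ℂ := (n : ℂ)⁻¹ * ∑ k ∈ Finset.range n, D m (k + 1) x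

/-- The Nörlund kernels `F_n = (1/Q_n) ∑_{k=1}^{n} q_{n-k} D_k` where
`Q_n = ∑_{k=0}^{n-1} q_k`. -/
def FK (q : ℕ → ℝ) (n : ℕ) (x : Gm m) : ℂ :=
  ((∑ k ∈ Finset.range n, q k : ℝ) : ℂ)⁻¹ *
    ∑ k ∈ Finset.range n, (q (n - (k + 1)) : ℂ) * D m (k + 1) x

/-- The cylinder subgroup `I_n = {x : x_0 = … = x_{n-1} = 0}`. -/
def I (n : ℕ) : Set (Gm m) := {x | ∀ k < n, x k = 0}

/-- The cylinder of length `n` around `x`. -/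
def cylAt (n : ℕ) (x : Gm m) : Set (Gm m) := {y | ∀ k < n, y k = x k}

/-- `μ` is the normalized Haar measure of `G_m`: the (unique) Borel probability
measure giving each cylinder of length `n` measure `1 / M_n`. -/
def IsHaar (μ : Measure (Gm m)) : Prop :=
  ∀ (n : ℕ) (x : Gm m), μ (cylAt m n x) = (M m n : ℝ≥0∞)⁻¹

/-- A martingale with respect to the filtration `(ℱ_n)` on `G_m`, where `ℱ_n` is
generated by the first `n` coordinates: each `f n` is integrable and depends only
on the first `n` coordinates, and the conditional expectation of `f N` with
respect to `ℱ_n` (which under the Haar measure is given by averaging over the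
cylinders of length `n`) equals `f n` for `n ≤ N`. -/
structure IsMartingale (μ : Measure (Gm m)) (f : ℕ → Gm m → ℂ) : Prop where
  integrable : ∀ n, Integrable (f n) μ
  adapted : ∀ (n : ℕ) (x y : Gm m), (∀ k < n, x k = y k) → f n x = f n y
  mart : ∀ n N : ℕ, n ≤ N → ∀ x : Gm m,
    f n x = (M m n : ℂ) * ∫ t in cylAt m n x, f N t ∂μ

/-- The Vilenkin–Fourier coefficients of a martingale:
`f̂(i) = lim_k ∫ f^(k) conj(ψ_i) dμ`; for a martingale these integrals are
constant as soon as `M_k > i`, in particular from `k = i + 1` on. -/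
def coeff (μ : Measure (Gm m)) (f : ℕ → Gm m → ℂ) (i : ℕ) : ℂ :=
  ∫ x, f (i + 1) x * (starRingEnd ℂ) (vil m i x) ∂μ

/-- The partial sums `S_n f = ∑_{k=0}^{n-1} f̂(k) ψ_k`. -/
def S (μ : Measure (Gm m)) (f : ℕ → Gm m → ℂ) (n : ℕ) (x : Gm m) : ℂ :=
  ∑ k ∈ Finset.range n, coeff m μ f k * vil m k x

/-- The Fejér means `σ_n f = (1/n) ∑_{k=1}^{n} S_k f`. -/
def sigma (μ : Measure (Gm m)) (f : ℕ → Gm m → ℂ) (n : ℕ) (x : Gm m) : ℂ :=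
  (n : ℂ)⁻¹ * ∑ k ∈ Finset.range n, S m μ f (k + 1) x

/-- The Nörlund means `t_n f = (1/Q_n) ∑_{k=1}^{n} q_{n-k} S_k f`. -/
def T (μ : Measure (Gm m)) (q : ℕ → ℝ) (f : ℕ → Gm m → ℂ) (n : ℕ) (x : Gm m) : ℂ :=
  ((∑ k ∈ Finset.range n, q k : ℝ) : ℂ)⁻¹ *
    ∑ k ∈ Finset.range n, (q (n - (k + 1)) : ℂ) * S m μ f (k + 1) x

/-- The martingale maximal function `f* = sup_n |f^(n)|`. -/
def mstar (f : ℕ → Gm m → ℂ) (x : Gm m) : ℝ≥0∞ := ⨆ n, (‖f n x‖₊ : ℝ≥0∞)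

/-- The `L_p`-type quasi-norm `(∫ g^p dμ)^{1/p}` of an `ℝ≥0∞`-valued function. -/
def eLp (μ : Measure (Gm m)) (p : ℝ) (g : Gm m → ℝ≥0∞) : ℝ≥0∞ :=
  (∫⁻ x, g x ^ p ∂μ) ^ (1 / p)

/-- Membership in the martingale Hardy space `H_p`: `‖f‖_{H_p} = ‖f*‖_{L_p} < ∞`. -/
def MemHp (μ : Measure (Gm m)) (p : ℝ) (f : ℕ → Gm m → ℂ) : Prop :=
  eLp m μ p (mstar m f) ≠ ⊤

/-- The weak-`L_p` quasi-norm `sup_{t>0} t · μ(g > t)^{1/p}`. -/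
def wLp (μ : Measure (Gm m)) (p : ℝ) (g : Gm m → ℝ≥0∞) : ℝ≥0∞ :=
  ⨆ t : ℝ≥0, (t : ℝ≥0∞) * μ {x | (t : ℝ≥0∞) < g x} ^ (1 / p)

end Vilenkin

theorem ENNReal.tsum_rpow_le_tsum_rpow {ι : Type*} (a : ι → ℝ≥0∞) {θ : ℝ} (h0 : 0 < θ)
    (h1 : θ ≤ 1) : (∑' i, a i) ^ θ ≤ ∑' i, a i ^ θ := by
  have hfin : ∀ s : Finset ι, (∑ i ∈ s, a i) ^ θ ≤ ∑ i ∈ s, a i ^ θ := by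
    intro s
    classical
    induction s using Finset.induction_on with
    | empty => simp [h0]
    | insert i s hi ih =>
      rw [Finset.sum_insert hi, Finset.sum_insert hi]
      exact (ENNReal.rpow_add_le_add_rpow _ _ h0.le h1).trans (by gcongr)
  have hlim := (ENNReal.continuous_rpow_const (y := θ)).continuousAt.tendsto.comp
    (ENNReal.summable (f := a)).hasSum
  exact le_of_tendsto hlim (Filter.Eventually.of_forall fun s =>
    (hfin s).trans (ENNReal.sum_le_tsum s))

namespace Vilenkin

/-- The sum of the geometric series with ratio `2 ^ (-θ)`. -/
def geomConst (θ : ℝ) : ℝ≥0∞ := (1 - (2 : ℝ≥0∞) ^ (-θ))⁻¹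

theorem geomConst_ne_top {θ : ℝ} (hθ : 0 < θ) : geomConst θ ≠ ⊤ := by
  have h : (2 : ℝ≥0∞) ^ (-θ) < 1 := ENNReal.rpow_lt_one_of_one_lt_of_neg (by norm_num) (by linarith)
  simpa [geomConst, tsub_eq_zero_iff_le] using h

theorem tsum_two_pow_rpow_neg (θ : ℝ) :
    ∑' n : ℕ, ((2 : ℝ≥0∞) ^ n) ^ (-θ) = geomConst θ := by
  rw [geomConst, ← ENNReal.tsum_geometric]
  congr 1
  ext n
  rw [← ENNReal.rpow_natCast, ← ENNReal.rpow_mul, mul_comm, ENNReal.rpow_mul, ENNReal.rpow_natCast]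

theorem tsum_dyadic_le {p : ℝ} (hp : 0 < p) (F : ℝ≥0∞) :
    ∑' i : ℤ, (if (2 : ℝ≥0∞) ^ i < F then ((2 : ℝ≥0∞) ^ i) ^ p else 0) ≤
      geomConst p * F ^ p := by
  rcases eq_or_ne F 0 with rfl | hF0
  · simp
  rcases eq_or_ne F ⊤ with rfl | hFt
  · rw [ENNReal.top_rpow_of_pos hp, ENNReal.mul_top]
    · exact le_top
    · simp [geomConst]
  obtain ⟨N, hN, hN'⟩ := ENNReal.exists_mem_Ioc_zpow hF0 hFt (y := 2) (by norm_num) (by norm_num)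
  have hinj : Function.Injective fun n : ℕ => N - (n : ℤ) := by
    intro a b h
    simpa using h
  rw [← hinj.tsum_eq]
  · calc ∑' n : ℕ, (if (2 : ℝ≥0∞) ^ (N - (n : ℤ)) < F then ((2 : ℝ≥0∞) ^ (N - (n : ℤ))) ^ p else 0)
        ≤ ∑' n : ℕ, ((2 : ℝ≥0∞) ^ n) ^ (-p) * F ^ p := by
          refine ENNReal.tsum_le_tsum fun n => ?_
          split_ifs
          · have : (2 : ℝ≥0∞) ^ (N - (n : ℤ)) = ((2 : ℝ≥0∞) ^ n)⁻¹ * 2 ^ N := by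
              rw [sub_eq_add_neg, ENNReal.zpow_add (by norm_num) (by norm_num), ENNReal.zpow_neg,
                zpow_natCast, mul_comm]
            rw [this, ENNReal.mul_rpow_of_nonneg _ _ hp.le, ENNReal.inv_rpow, ENNReal.rpow_neg]
            gcongr
          · exact zero_le
      _ = geomConst p * F ^ p := by rw [ENNReal.tsum_mul_right, tsum_two_pow_rpow_neg]
  · intro i hi
    have hi' : (2 : ℝ≥0∞) ^ i < F := by
      by_contra h
      simp [h] at hi
    have hlt : i < N + 1 := by
      by_contra h
      have := ENNReal.zpow_le_of_le (x := 2) (by norm_num) (not_lt.mp h)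
      exact absurd (hi'.trans_le hN') (not_lt.mpr this)
    exact ⟨(N - i).toNat, by simp; omega⟩

theorem M_pos {m : ℕ → ℕ} (hm : ∀ k, 2 ≤ m k) (n : ℕ) : 0 < M m n := by
  induction n with
  | zero => simp [M]
  | succ n ih => exact Nat.mul_pos (by linarith [hm n]) ih

theorem two_pow_mul_M_le {m : ℕ → ℕ} (hm : ∀ k, 2 ≤ m k) (n i : ℕ) :
    2 ^ i * M m n ≤ M m (i + n) := by
  induction i with
  | zero => simp
  | succ i ih =>
    rw [show i + 1 + n = (i + n) + 1 by ring, M, pow_succ, mul_comm (2 ^ i), mul_assoc]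
    exact Nat.mul_le_mul (hm _) ih

theorem lt_M {m : ℕ → ℕ} (hm : ∀ k, 2 ≤ m k) (n : ℕ) : n < M m n :=
  n.lt_two_pow_self.trans_le (by simpa [M] using two_pow_mul_M_le hm 0 n)

theorem M_mono {m : ℕ → ℕ} (hm : ∀ k, 2 ≤ m k) : Monotone (M m) :=
  monotone_nat_of_le_succ fun n => by
    have := two_pow_mul_M_le hm n 1
    rw [add_comm 1 n] at this
    omega

theorem tsum_M_rpow_le {m : ℕ → ℕ} (hm : ∀ k, 2 ≤ m k) {θ : ℝ} (hθ : 0 < θ) (A : ℝ≥0∞) :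
    ∑' j : ℕ, (if 1 ≤ (M m j : ℝ≥0∞) * A then (M m j : ℝ≥0∞) ^ (-θ) else 0) ≤
      geomConst θ * A ^ θ := by
  classical
  by_cases hex : ∃ j, 1 ≤ (M m j : ℝ≥0∞) * A
  · set j₀ := Nat.find hex
    have hj₀ : 1 ≤ (M m j₀ : ℝ≥0∞) * A := Nat.find_spec hex
    rw [← ENNReal.summable.sum_add_tsum_nat_add' (k := j₀), Finset.sum_eq_zero, zero_add]
    · calc _ ≤ ∑' i : ℕ, ((2 : ℝ≥0∞) ^ i) ^ (-θ) * A ^ θ := by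
            refine ENNReal.tsum_le_tsum fun i => ?_
            split_ifs
            · rw [ENNReal.rpow_neg, ENNReal.rpow_neg, ← ENNReal.inv_rpow, ← ENNReal.inv_rpow,
                ← ENNReal.mul_rpow_of_nonneg _ _ hθ.le]
              refine ENNReal.rpow_le_rpow ?_ hθ.le
              have h1 : (M m j₀ : ℝ≥0∞)⁻¹ ≤ A := by
                rw [ENNReal.inv_le_iff_le_mul]
                · exact hj₀
                · intro _; simp [(M_pos hm _).ne']
                · intro _ h; simp [h] at hj₀
              have h2 : ((2 : ℝ≥0∞) ^ i * M m j₀) ≤ M m (i + j₀) := by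
                exact_mod_cast two_pow_mul_M_le hm j₀ i
              calc (M m (i + j₀) : ℝ≥0∞)⁻¹ ≤ ((2 : ℝ≥0∞) ^ i * M m j₀)⁻¹ := ENNReal.inv_le_inv.mpr h2
                _ = ((2 : ℝ≥0∞) ^ i)⁻¹ * (M m j₀ : ℝ≥0∞)⁻¹ := by
                  rw [ENNReal.mul_inv] <;> simp
                _ ≤ _ := by gcongr
            · exact zero_le
        _ = _ := by rw [ENNReal.tsum_mul_right, tsum_two_pow_rpow_neg]
    · intro j hj
      exact if_neg (Nat.find_min hex (Finset.mem_range.mp hj))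
  · push Not at hex
    simp [fun j => not_le.mpr (hex j)]

theorem tsum_M_rpow_mul_lintegral_le {m : ℕ → ℕ} (hm : ∀ k, 2 ≤ m k) {p : ℝ} (hp0 : 0 < p)
    (hp1 : p ≤ 1) {μ : Measure (Gm m)} (hμ : IsHaar m μ) {f : ℕ → Gm m → ℂ}
    (hf : IsMartingale m μ f) :
    ∑' j : ℕ, (M m j : ℝ≥0∞) ^ (-(1 - p / 2)) * (∫⁻ x, ‖f j x‖ₑ ^ (2 : ℝ) ∂μ) ^ (p / 2) ≤
      2 ^ p * geomConst (1 - p / 2) * geomConst p * ∫⁻ x, mstar m f x ^ p ∂μ := by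
  have hmeas : ∀ j, AEMeasurable (fun x => ‖f j x‖ₑ) μ := fun j => (hf.integrable j).1.enorm
  have hsmeas : AEMeasurable (mstar m f) μ := AEMeasurable.iSup hmeas
  have hle : ∀ j x, ‖f j x‖ₑ ≤ mstar m f x := fun j x => le_iSup (fun n => ‖f n x‖ₑ) j
  set a : ℕ → ℤ → ℝ≥0∞ := fun j i => μ {x | (2 : ℝ≥0∞) ^ i < ‖f j x‖ₑ}
  set A : ℤ → ℝ≥0∞ := fun i => μ {x | (2 : ℝ≥0∞) ^ i < mstar m f x}
  have haA : ∀ j i, a j i ≤ A i := fun j i =>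
    measure_mono fun x hx => lt_of_lt_of_le hx (hle j x)
  have haM : ∀ j i, a j i ≠ 0 → 1 ≤ (M m j : ℝ≥0∞) * a j i := by
    intro j i h
    obtain ⟨x, hx⟩ := nonempty_of_measure_ne_zero h
    have hsub : cylAt m j x ⊆ {x | (2 : ℝ≥0∞) ^ i < ‖f j x‖ₑ} := by
      intro y hy
      have : f j y = f j x := hf.adapted j y x hy
      simpa [this] using hx
    have h2 := measure_mono (μ := μ) hsub
    rw [hμ] at h2
    calc (1 : ℝ≥0∞) = M m j * (M m j : ℝ≥0∞)⁻¹ := by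
          rw [ENNReal.mul_inv_cancel] <;> simp [(M_pos hm j).ne']
      _ ≤ _ := by gcongr
  have hterm : ∀ j i, (M m j : ℝ≥0∞) ^ (-(1 - p / 2)) * (a j i) ^ (p / 2) ≤
      A i ^ (p / 2) * (if 1 ≤ (M m j : ℝ≥0∞) * A i then
        (M m j : ℝ≥0∞) ^ (-(1 - p / 2)) else 0) := by
    intro j i
    by_cases h : a j i = 0
    · rw [h, ENNReal.zero_rpow_of_pos (by linarith), mul_zero]
      exact zero_le
    · have : 1 ≤ (M m j : ℝ≥0∞) * A i := (haM j i h).trans (by gcongr; exact haA j i)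
      rw [if_pos this, mul_comm]
      gcongr
      exact haA j i
  have hindm : ∀ (g : Gm m → ℝ≥0∞) (i : ℤ) (c : ℝ≥0∞), AEMeasurable g μ →
      AEMeasurable (fun x => if (2 : ℝ≥0∞) ^ i < g x then c else 0) μ := by
    intro g i c hg
    have : Measurable fun y : ℝ≥0∞ => if (2 : ℝ≥0∞) ^ i < y then c else 0 :=
      Measurable.ite measurableSet_Ioi measurable_const measurable_const
    exact this.comp_aemeasurable hg
  have hindi : ∀ (g : Gm m → ℝ≥0∞) (i : ℤ) (c : ℝ≥0∞), AEMeasurable g μ →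
      ∫⁻ x, (if (2 : ℝ≥0∞) ^ i < g x then c else 0) ∂μ = c * μ {x | (2 : ℝ≥0∞) ^ i < g x} := by
    intro g i c hg
    rw [← lintegral_indicator_const₀ (nullMeasurableSet_lt aemeasurable_const hg)]
    simp only [Set.indicator_apply, Set.mem_ofPred_eq]
  have hL2 : ∀ j, ∫⁻ x, ‖f j x‖ₑ ^ (2 : ℝ) ∂μ ≤ ∑' i : ℤ, (2 * (2 : ℝ≥0∞) ^ i) ^ (2 : ℝ) * a j i := by
    intro j
    calc ∫⁻ x, ‖f j x‖ₑ ^ (2 : ℝ) ∂μ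
        ≤ ∫⁻ x, ∑' i : ℤ, (if (2 : ℝ≥0∞) ^ i < ‖f j x‖ₑ then
            (2 * (2 : ℝ≥0∞) ^ i) ^ (2 : ℝ) else 0) ∂μ := by
          refine lintegral_mono fun x => ?_
          rcases eq_or_ne ‖f j x‖ₑ 0 with h0 | h0
          · simp [h0]
          obtain ⟨N, hN, hN'⟩ := ENNReal.exists_mem_Ioc_zpow h0 enorm_ne_top (y := 2)
            (by norm_num) (by norm_num)
          refine le_trans ?_ (ENNReal.le_tsum N)
          rw [if_pos hN]
          rw [ENNReal.zpow_add (by norm_num) (by norm_num), zpow_one, mul_comm] at hN'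
          gcongr
      _ = _ := by
          rw [lintegral_tsum fun i => hindm _ i _ (hmeas j)]
          exact tsum_congr fun i => hindi _ i _ (hmeas j)
  have hj : ∀ j, (M m j : ℝ≥0∞) ^ (-(1 - p / 2)) * (∫⁻ x, ‖f j x‖ₑ ^ (2 : ℝ) ∂μ) ^ (p / 2) ≤
      ∑' i : ℤ, (2 * (2 : ℝ≥0∞) ^ i) ^ p * (A i ^ (p / 2) * (if 1 ≤ (M m j : ℝ≥0∞) * A i then
        (M m j : ℝ≥0∞) ^ (-(1 - p / 2)) else 0)) := by
    intro j
    calc _ ≤ (M m j : ℝ≥0∞) ^ (-(1 - p / 2)) *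
          ∑' i : ℤ, ((2 * (2 : ℝ≥0∞) ^ i) ^ (2 : ℝ) * a j i) ^ (p / 2) := by
          gcongr
          exact (ENNReal.rpow_le_rpow (hL2 j) (by linarith)).trans
            (ENNReal.tsum_rpow_le_tsum_rpow _ (by linarith) (by linarith))
      _ = ∑' i : ℤ, (2 * (2 : ℝ≥0∞) ^ i) ^ p *
          ((M m j : ℝ≥0∞) ^ (-(1 - p / 2)) * (a j i) ^ (p / 2)) := by
          rw [← ENNReal.tsum_mul_left]
          refine tsum_congr fun i => ?_
          rw [ENNReal.mul_rpow_of_nonneg _ _ (by linarith), ← ENNReal.rpow_mul,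
            mul_div_cancel₀ p two_ne_zero]
          ring
      _ ≤ _ := ENNReal.tsum_le_tsum fun i => mul_le_mul_right (hterm j i) _
  calc _ ≤ ∑' j : ℕ, ∑' i : ℤ, (2 * (2 : ℝ≥0∞) ^ i) ^ p * (A i ^ (p / 2) *
        (if 1 ≤ (M m j : ℝ≥0∞) * A i then (M m j : ℝ≥0∞) ^ (-(1 - p / 2)) else 0)) :=
        ENNReal.tsum_le_tsum hj
    _ = ∑' i : ℤ, (2 * (2 : ℝ≥0∞) ^ i) ^ p * (A i ^ (p / 2) * ∑' j : ℕ,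
        (if 1 ≤ (M m j : ℝ≥0∞) * A i then (M m j : ℝ≥0∞) ^ (-(1 - p / 2)) else 0)) := by
        rw [ENNReal.tsum_comm]
        simp_rw [ENNReal.tsum_mul_left]
    _ ≤ ∑' i : ℤ, (2 * (2 : ℝ≥0∞) ^ i) ^ p * (A i ^ (p / 2) *
        (geomConst (1 - p / 2) * A i ^ (1 - p / 2))) := by
        refine ENNReal.tsum_le_tsum fun i => ?_
        gcongr
        exact tsum_M_rpow_le hm (by linarith) _
    _ = 2 ^ p * geomConst (1 - p / 2) * ∑' i : ℤ, ((2 : ℝ≥0∞) ^ i) ^ p * A i := by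
        rw [← ENNReal.tsum_mul_left]
        refine tsum_congr fun i => ?_
        have : A i = A i ^ (p / 2) * A i ^ (1 - p / 2) := by
          rw [← ENNReal.rpow_add_of_nonneg _ _ (by linarith) (by linarith)]
          simp
        rw [ENNReal.mul_rpow_of_nonneg _ _ hp0.le]
        conv_rhs => rw [this]
        ring
    _ = 2 ^ p * geomConst (1 - p / 2) * ∫⁻ x, ∑' i : ℤ,
        (if (2 : ℝ≥0∞) ^ i < mstar m f x then ((2 : ℝ≥0∞) ^ i) ^ p else 0) ∂μ := by
        rw [lintegral_tsum fun i => hindm _ i _ hsmeas]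
        congr 1
        exact tsum_congr fun i => (hindi _ i _ hsmeas).symm
    _ ≤ 2 ^ p * geomConst (1 - p / 2) * ∫⁻ x, geomConst p * mstar m f x ^ p ∂μ := by
        gcongr with x
        exact tsum_dyadic_le hp0 _
    _ = _ := by
        rw [lintegral_const_mul'' _ (hsmeas.pow_const p)]
        ring


theorem measurableSet_cylAt (m : ℕ → ℕ) (n : ℕ) (x : Gm m) : MeasurableSet (cylAt m n x) := by
  have : cylAt m n x = ⋂ k, ⋂ _ : k < n, (fun y : Gm m => y k) ⁻¹' {x k} := by
    ext y
    simp [cylAt]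
  rw [this]
  exact MeasurableSet.iInter fun k => MeasurableSet.iInter fun _ =>
    measurable_pi_apply k MeasurableSpace.measurableSet_top

theorem IsHaar.isProbabilityMeasure {m : ℕ → ℕ} {μ : Measure (Gm m)} (hμ : IsHaar m μ) :
    IsProbabilityMeasure μ := ⟨by
  have h := hμ 0 0
  have : cylAt m 0 0 = Set.univ := by
    ext y
    simp [cylAt]
  rwa [this, M, Nat.cast_one, inv_one] at h⟩

/-- The point of `G_m` whose first `n` coordinates are given and whose other coordinates vanish. -/
def extendZero (m : ℕ → ℕ) (n : ℕ) (c : ∀ k : Fin n, ZMod (m k)) : Gm m :=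
  fun k => if h : k < n then c ⟨k, h⟩ else 0

theorem extendZero_apply (m : ℕ → ℕ) (n : ℕ) (c : ∀ k : Fin n, ZMod (m k)) (k : Fin n) :
    extendZero m n c k = c k := by
  simp [extendZero]

theorem mem_cylAt_extendZero {m : ℕ → ℕ} {n : ℕ} {c : ∀ k : Fin n, ZMod (m k)} {y : Gm m} :
    y ∈ cylAt m n (extendZero m n c) ↔ c = fun k : Fin n => y k := by
  constructor
  · intro h
    ext k
    rw [h k k.2, extendZero_apply]
  · rintro rfl k hk
    simp [extendZero, hk]

theorem integral_mul_eq_sum {m : ℕ → ℕ} [∀ k, NeZero (m k)] {μ : Measure (Gm m)} {n : ℕ}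
    {g h : Gm m → ℂ} (hg : ∀ x y : Gm m, (∀ k < n, x k = y k) → g x = g y)
    (hh : Integrable h μ) :
    ∫ x, h x * g x ∂μ = ∑ c : (∀ k : Fin n, ZMod (m k)),
      (∫ x in cylAt m n (extendZero m n c), h x ∂μ) * g (extendZero m n c) := by
  have hpt : ∀ x, h x * g x = ∑ c : (∀ k : Fin n, ZMod (m k)),
      (cylAt m n (extendZero m n c)).indicator h x * g (extendZero m n c) := by
    intro x
    rw [Finset.sum_eq_single (fun k : Fin n => x k)]
    · have hx : x ∈ cylAt m n (extendZero m n fun k : Fin n => x k) := mem_cylAt_extendZero.mpr rfl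
      rw [Set.indicator_of_mem hx, hg _ _ hx]
    · intro c _ hc
      rw [Set.indicator_of_notMem (fun hx => hc (mem_cylAt_extendZero.mp hx)), zero_mul]
    · simp
  simp_rw [hpt]
  rw [integral_finsetSum]
  · refine Finset.sum_congr rfl fun c _ => ?_
    rw [integral_mul_const, integral_indicator (measurableSet_cylAt m n _)]
  · exact fun c _ => (hh.indicator (measurableSet_cylAt m n _)).mul_const _

theorem integral_eq_sum {m : ℕ → ℕ} [∀ k, NeZero (m k)] {μ : Measure (Gm m)} (hμ : IsHaar m μ)
    {n : ℕ} {g : Gm m → ℂ} (hg : ∀ x y : Gm m, (∀ k < n, x k = y k) → g x = g y) :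
    ∫ x, g x ∂μ = (M m n : ℂ)⁻¹ * ∑ c : (∀ k : Fin n, ZMod (m k)), g (extendZero m n c) := by
  have := hμ.isProbabilityMeasure
  have h := integral_mul_eq_sum (μ := μ) hg (integrable_const 1)
  simp only [one_mul] at h
  rw [h, Finset.mul_sum]
  refine Finset.sum_congr rfl fun c _ => ?_
  simp [Measure.real, hμ n]

theorem IsMartingale.integral_mul_eq {m : ℕ → ℕ} (hm : ∀ k, 2 ≤ m k) {μ : Measure (Gm m)}
    {f : ℕ → Gm m → ℂ} (hf : IsMartingale m μ f) {n N : ℕ} (hnN : n ≤ N) {g : Gm m → ℂ}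
    (hg : ∀ x y : Gm m, (∀ k < n, x k = y k) → g x = g y) :
    ∫ x, f N x * g x ∂μ = ∫ x, f n x * g x ∂μ := by
  have : ∀ k, NeZero (m k) := fun k => ⟨by linarith [hm k]⟩
  rw [integral_mul_eq_sum hg (hf.integrable N), integral_mul_eq_sum hg (hf.integrable n)]
  refine Finset.sum_congr rfl fun c _ => ?_
  have hM : (M m n : ℂ) ≠ 0 := by exact_mod_cast (M_pos hm n).ne'
  congr 1
  apply mul_left_cancel₀ hM
  rw [← hf.mart n N hnN, ← hf.mart n n le_rfl]

theorem digit_eq_zero {m : ℕ → ℕ} {i k : ℕ} (h : i < M m k) : digit m i k = 0 := by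
  simp [digit, Nat.div_eq_of_lt h]

theorem vil_eq_prod {m : ℕ → ℕ} (hm : ∀ k, 2 ≤ m k) {i n : ℕ} (hi : i < M m n) (x : Gm m) :
    vil m i x = ∏ k ∈ Finset.range n, rad m k x ^ digit m i k := by
  have hzero : ∀ k, (n ≤ k ∨ i + 1 ≤ k) → rad m k x ^ digit m i k = 1 := by
    rintro k (hk | hk)
    · rw [digit_eq_zero (hi.trans_le (M_mono hm hk)), pow_zero]
    · rw [digit_eq_zero ((Nat.lt_of_succ_le hk).trans (lt_M hm k)), pow_zero]
  rcases le_total n (i + 1) with h | h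
  · exact (Finset.prod_subset (Finset.range_mono h) fun k _ hk =>
      hzero k (Or.inl (by simpa using hk))).symm
  · exact Finset.prod_subset (Finset.range_mono h) fun k _ hk =>
      hzero k (Or.inr (by simpa using hk))

theorem vil_congr {m : ℕ → ℕ} (hm : ∀ k, 2 ≤ m k) {i n : ℕ} (hi : i < M m n) (x y : Gm m)
    (h : ∀ k < n, x k = y k) : vil m i x = vil m i y := by
  rw [vil_eq_prod hm hi, vil_eq_prod hm hi]
  refine Finset.prod_congr rfl fun k hk => ?_
  rw [rad, rad, h k (Finset.mem_range.mp hk)]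

theorem mod_M_succ (m : ℕ → ℕ) (i n : ℕ) :
    i % M m (n + 1) = i % M m n + M m n * digit m i n := by
  rw [M, mul_comm, Nat.mod_mul, digit]

theorem eq_of_digit_eq {m : ℕ → ℕ} {i j n : ℕ} (hi : i < M m n) (hj : j < M m n)
    (h : ∀ k < n, digit m i k = digit m j k) : i = j := by
  have key : ∀ N ≤ n, i % M m N = j % M m N := by
    intro N
    induction N with
    | zero => intro _; simp [M, Nat.mod_one]
    | succ N ih =>
      intro hN
      rw [mod_M_succ, mod_M_succ, ih (by omega), h N (by omega)]
  have := key n le_rfl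
  rwa [Nat.mod_eq_of_lt hi, Nat.mod_eq_of_lt hj] at this

theorem norm_rad (m : ℕ → ℕ) (k : ℕ) (x : Gm m) : ‖rad m k x‖ = 1 := by
  rw [rad, show (2 * Real.pi * Complex.I * ((x k).val : ℂ) / (m k : ℂ)) =
    ((2 * Real.pi * (x k).val / m k : ℝ) : ℂ) * Complex.I by push_cast; ring]
  exact Complex.norm_exp_ofReal_mul_I _

theorem norm_vil (m : ℕ → ℕ) (i : ℕ) (x : Gm m) : ‖vil m i x‖ = 1 := by
  simp [vil, norm_prod, norm_rad]

theorem measurable_vil (m : ℕ → ℕ) (i : ℕ) : Measurable (vil m i) := by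
  refine Finset.measurable_prod _ fun k _ => Measurable.pow_const ?_ _
  have h : Measurable fun a : ZMod (m k) =>
      Complex.exp (2 * Real.pi * Complex.I * (a.val : ℂ) / (m k : ℂ)) := measurable_from_top
  exact h.comp (measurable_pi_apply k)

/-- Orthogonality of the characters `a ↦ exp (2πi a d / q)` of `ℤ_q`. -/
theorem sum_exp_mul_conj_eq_zero {q : ℕ} [NeZero q] {d e : ℕ} (hd : d < q) (he : e < q)
    (hde : d ≠ e) :
    ∑ a : ZMod q, Complex.exp (2 * Real.pi * Complex.I * (a.val : ℂ) / (q : ℂ)) ^ d *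
      (starRingEnd ℂ) (Complex.exp (2 * Real.pi * Complex.I * (a.val : ℂ) / (q : ℂ)) ^ e) = 0 := by
  have hq : q ≠ 0 := NeZero.ne q
  set ζ := Complex.exp (2 * Real.pi * Complex.I / q)
  have hζ : IsPrimitiveRoot ζ q := Complex.isPrimitiveRoot_exp q hq
  have hnorm : ‖ζ‖ = 1 := hζ.norm'_eq_one hq
  have hexp : ∀ a : ZMod q,
      Complex.exp (2 * Real.pi * Complex.I * (a.val : ℂ) / (q : ℂ)) = ζ ^ a.val := by
    intro a
    rw [← Complex.exp_nat_mul]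
    congr 1
    ring
  have hconj : (starRingEnd ℂ) ζ = ζ⁻¹ := (Complex.inv_eq_conj hnorm).symm
  have hζ0 : ζ ≠ 0 := hζ.ne_zero hq
  set w := ζ ^ d * (ζ⁻¹) ^ e
  have hw1 : w ≠ 1 := by
    intro h
    have : ζ ^ d = ζ ^ e := by
      simpa [w, inv_pow, mul_inv_eq_one₀ (pow_ne_zero e hζ0)] using h
    exact hde (hζ.pow_inj hd he this)
  have hwq : w ^ q = 1 := by
    rw [mul_pow, ← pow_mul, ← pow_mul, mul_comm d, mul_comm e, pow_mul, pow_mul, inv_pow,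
      hζ.pow_eq_one]
    simp
  have hterm : ∀ a : ZMod q, Complex.exp (2 * Real.pi * Complex.I * (a.val : ℂ) / (q : ℂ)) ^ d *
      (starRingEnd ℂ) (Complex.exp (2 * Real.pi * Complex.I * (a.val : ℂ) / (q : ℂ)) ^ e) =
      w ^ a.val := by
    intro a
    rw [hexp, map_pow, map_pow, hconj, mul_pow, ← pow_mul, ← pow_mul, ← pow_mul, ← pow_mul,
      mul_comm d, mul_comm e]
  simp_rw [hterm]
  obtain ⟨r, rfl⟩ := Nat.exists_eq_succ_of_ne_zero hq
  have : ∑ a : ZMod (r + 1), w ^ a.val = ∑ k ∈ Finset.range (r + 1), w ^ k :=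
    Fin.sum_univ_eq_sum_range (fun k => w ^ k) (r + 1)
  rw [this, geom_sum_eq hw1, hwq, sub_self, zero_div]

theorem integral_vil_mul_conj {m : ℕ → ℕ} (hm : ∀ k, 2 ≤ m k) {μ : Measure (Gm m)}
    (hμ : IsHaar m μ) {i j : ℕ} (hij : i ≠ j) :
    ∫ x, vil m i x * (starRingEnd ℂ) (vil m j x) ∂μ = 0 := by
  have : ∀ k, NeZero (m k) := fun k => ⟨by linarith [hm k]⟩
  set n := max i j
  have hi : i < M m n := (le_max_left i j).trans_lt (lt_M hm n)
  have hj : j < M m n := (le_max_right i j).trans_lt (lt_M hm n)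
  obtain ⟨k, hk, hne⟩ : ∃ k < n, digit m i k ≠ digit m j k := by
    by_contra! h
    exact hij (eq_of_digit_eq hi hj h)
  rw [integral_eq_sum hμ (n := n) fun x y h => by
    rw [vil_congr hm hi x y h, vil_congr hm hj x y h]]
  let F : ∀ l : Fin n, ZMod (m l) → ℂ := fun l a =>
    Complex.exp (2 * Real.pi * Complex.I * (a.val : ℂ) / (m l : ℂ)) ^ digit m i l *
      (starRingEnd ℂ) (Complex.exp (2 * Real.pi * Complex.I * (a.val : ℂ) / (m l : ℂ)) ^ digit m j l)
  have hF : ∀ c : (∀ l : Fin n, ZMod (m l)), vil m i (extendZero m n c) *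
      (starRingEnd ℂ) (vil m j (extendZero m n c)) = ∏ l, F l (c l) := by
    intro c
    rw [vil_eq_prod hm hi, vil_eq_prod hm hj, map_prod, ← Finset.prod_mul_distrib,
      ← Fin.prod_univ_eq_prod_range (fun k => rad m k (extendZero m n c) ^ digit m i k *
        (starRingEnd ℂ) (rad m k (extendZero m n c) ^ digit m j k))]
    refine Finset.prod_congr rfl fun l _ => ?_
    simp only [rad, extendZero_apply, F]
  simp_rw [hF]
  rw [← Fintype.piFinset_univ, ← Finset.prod_univ_sum, Finset.prod_eq_zero (i := ⟨k, hk⟩), mul_zero]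
  · exact Finset.mem_univ _
  · exact sum_exp_mul_conj_eq_zero (Nat.mod_lt _ (by linarith [hm k]))
      (Nat.mod_lt _ (by linarith [hm k])) hne

/-- Bessel's inequality for the Vilenkin system. -/
theorem sum_enorm_integral_rpow_le {m : ℕ → ℕ} (hm : ∀ k, 2 ≤ m k) {μ : Measure (Gm m)}
    (hμ : IsHaar m μ) {g : Gm m → ℂ} (hg : AEStronglyMeasurable g μ) (s : Finset ℕ) :
    ∑ i ∈ s, ‖∫ x, g x * (starRingEnd ℂ) (vil m i x) ∂μ‖ₑ ^ (2 : ℝ) ≤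
      ∫⁻ x, ‖g x‖ₑ ^ (2 : ℝ) ∂μ := by
  have := hμ.isProbabilityMeasure
  rcases eq_or_ne (∫⁻ x, ‖g x‖ₑ ^ (2 : ℝ) ∂μ) ⊤ with htop | htop
  · rw [htop]
    exact le_top
  have hgn : eLpNorm g 2 μ = (∫⁻ x, ‖g x‖ₑ ^ (2 : ℝ) ∂μ) ^ (1 / 2 : ℝ) := by
    rw [eLpNorm_eq_lintegral_rpow_enorm_toReal (by norm_num) (by norm_num)]
    simp
  have hgL : MemLp g 2 μ := ⟨hg, by
    rw [hgn]
    exact ENNReal.rpow_lt_top_of_nonneg (by norm_num) htop⟩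
  have hv : ∀ i, MemLp (vil m i) 2 μ := fun i =>
    MemLp.of_bound (measurable_vil m i).aestronglyMeasurable 1
      (Filter.Eventually.of_forall fun x => (norm_vil m i x).le)
  have hinner : ∀ (i : ℕ) {h : Gm m → ℂ} (hh : MemLp h 2 μ),
      inner ℂ ((hv i).toLp (vil m i)) (hh.toLp h) =
        ∫ x, h x * (starRingEnd ℂ) (vil m i x) ∂μ := by
    intro i h hh
    rw [L2.inner_def]
    refine integral_congr_ae ?_
    filter_upwards [(hv i).coeFn_toLp, hh.coeFn_toLp] with x h1 h2
    rw [h1, h2]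
    simp [inner]
  have horth : Orthonormal ℂ fun i => (hv i).toLp (vil m i) := by
    rw [orthonormal_iff_ite]
    intro i j
    rw [hinner]
    split_ifs with h
    · subst h
      simp [Complex.mul_conj, Complex.normSq_eq_norm_sq, norm_vil]
    · exact integral_vil_mul_conj hm hμ (Ne.symm h)
  have hB := horth.sum_inner_products_le (s := s) (hgL.toLp g)
  simp only [hinner] at hB
  have hB' := ENNReal.ofReal_le_ofReal hB
  rw [ENNReal.ofReal_sum_of_nonneg (fun _ _ => by positivity)] at hB'
  simp only [ENNReal.ofReal_pow (norm_nonneg _), ofReal_norm, Lp.enorm_toLp] at hB'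
  calc _ = _ := by
        refine Finset.sum_congr rfl fun i _ => ?_
        rw [ENNReal.rpow_two]
    _ ≤ _ := hB'
    _ = _ := by
        rw [hgn, ← ENNReal.rpow_two, ← ENNReal.rpow_mul]
        simp

theorem sum_coeff_block_le {m : ℕ → ℕ} (hm : ∀ k, 2 ≤ m k) {lam : ℕ} (hlam : ∀ k, m k ≤ lam)
    {p : ℝ} (hp0 : 0 < p) (hp1 : p ≤ 1) {μ : Measure (Gm m)} (hμ : IsHaar m μ)
    {f : ℕ → Gm m → ℂ} (hf : IsMartingale m μ f) (j : ℕ) :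
    ∑ k ∈ Finset.Ico (M m j) (M m (j + 1)), ‖coeff m μ f k‖ₑ ^ p / (k : ℝ≥0∞) ^ (2 - p) ≤
      (lam : ℝ≥0∞) ^ (2 - p) * ((M m (j + 1) : ℝ≥0∞) ^ (-(1 - p / 2)) *
        (∫⁻ x, ‖f (j + 1) x‖ₑ ^ (2 : ℝ) ∂μ) ^ (p / 2)) := by
  set B := Finset.Ico (M m j) (M m (j + 1))
  set X := ∫⁻ x, ‖f (j + 1) x‖ₑ ^ (2 : ℝ) ∂μ
  set Q : ℝ≥0∞ := (M m (j + 1) : ℝ≥0∞) with hQ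
  have hQ0 : Q ≠ 0 := by simp [hQ, (M_pos hm _).ne']
  have hQt : Q ≠ ⊤ := by simp [hQ]
  have hcoeff : ∀ k ∈ B, coeff m μ f k =
      ∫ x, f (j + 1) x * (starRingEnd ℂ) (vil m k x) ∂μ := by
    intro k hk
    obtain ⟨h1, h2⟩ := Finset.mem_Ico.mp hk
    refine hf.integral_mul_eq hm (by have := lt_M hm j; omega) fun x y h => ?_
    rw [vil_congr hm h2 x y h]
  have hbessel : ∑ k ∈ B, ‖coeff m μ f k‖ₑ ^ (2 : ℝ) ≤ X := by
    rw [Finset.sum_congr rfl fun k hk => by rw [hcoeff k hk]]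
    exact sum_enorm_integral_rpow_le hm hμ (hf.integrable (j + 1)).1 B
  have hholder : ∑ k ∈ B, ‖coeff m μ f k‖ₑ ^ p ≤ Q ^ (1 - p / 2) * X ^ (p / 2) := by
    have h := ENNReal.rpow_sum_le_const_mul_sum_rpow B (fun k => ‖coeff m μ f k‖ₑ ^ p)
      (p := 2 / p) (by rw [le_div_iff₀ hp0]; linarith)
    simp_rw [← ENNReal.rpow_mul, mul_div_cancel₀ (2 : ℝ) hp0.ne'] at h
    have hcard : (B.card : ℝ≥0∞) ≤ Q := by
      rw [hQ]
      exact_mod_cast (by simp [B] : B.card ≤ M m (j + 1))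
    have hexp : 0 ≤ 2 / p - 1 := by
      rw [sub_nonneg, le_div_iff₀ hp0]; linarith
    have h' : (∑ k ∈ B, ‖coeff m μ f k‖ₑ ^ p) ^ (2 / p) ≤ Q ^ (2 / p - 1) * X := by
      refine h.trans ?_
      gcongr
    have h2 := ENNReal.rpow_le_rpow h' (by positivity : 0 ≤ p / 2)
    rw [← ENNReal.rpow_mul, ENNReal.mul_rpow_of_nonneg _ _ (by positivity : 0 ≤ p / 2),
      ← ENNReal.rpow_mul] at h2
    convert h2 using 1
    · rw [show 2 / p * (p / 2) = 1 by field_simp, ENNReal.rpow_one]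
    · rw [show (2 / p - 1) * (p / 2) = 1 - p / 2 by field_simp]
  have hk : ∀ k ∈ B, ((k : ℝ≥0∞) ^ (2 - p))⁻¹ ≤ (lam : ℝ≥0∞) ^ (2 - p) * Q ^ (-(2 - p)) := by
    intro k hk
    have h1 := (Finset.mem_Ico.mp hk).1
    have hk0 : (k : ℝ≥0∞) ≠ 0 := by
      have := M_pos hm j
      simp; omega
    have h2 : Q ≤ lam * k := by
      rw [hQ]
      exact_mod_cast Nat.mul_le_mul (hlam j) h1
    have h3 : Q ^ (2 - p) ≤ (lam : ℝ≥0∞) ^ (2 - p) * (k : ℝ≥0∞) ^ (2 - p) := by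
      rw [← ENNReal.mul_rpow_of_nonneg _ _ (by linarith)]
      exact ENNReal.rpow_le_rpow h2 (by linarith)
    have hkp0 : (k : ℝ≥0∞) ^ (2 - p) ≠ 0 := by
      simp [ENNReal.rpow_eq_zero_iff, hk0]
    have hkpt : (k : ℝ≥0∞) ^ (2 - p) ≠ ⊤ :=
      ENNReal.rpow_ne_top_of_nonneg (by linarith) (by simp)
    have hQp0 : Q ^ (2 - p) ≠ 0 := by
      simp [ENNReal.rpow_eq_zero_iff, hQ0, hQt]
    have hQpt : Q ^ (2 - p) ≠ ⊤ := ENNReal.rpow_ne_top_of_nonneg (by linarith) hQt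
    rw [ENNReal.rpow_neg, ← div_eq_mul_inv, ENNReal.le_div_iff_mul_le (Or.inl hQp0) (Or.inl hQpt),
      mul_comm, ← div_eq_mul_inv, ENNReal.div_le_iff hkp0 hkpt]
    exact h3
  calc ∑ k ∈ B, ‖coeff m μ f k‖ₑ ^ p / (k : ℝ≥0∞) ^ (2 - p)
      ≤ ∑ k ∈ B, ‖coeff m μ f k‖ₑ ^ p * ((lam : ℝ≥0∞) ^ (2 - p) * Q ^ (-(2 - p))) := by
        refine Finset.sum_le_sum fun k h => ?_
        rw [div_eq_mul_inv]
        gcongr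
        exact hk k h
    _ ≤ (Q ^ (1 - p / 2) * X ^ (p / 2)) * ((lam : ℝ≥0∞) ^ (2 - p) * Q ^ (-(2 - p))) := by
        rw [← Finset.sum_mul]
        gcongr
    _ = _ := by
        rw [show -(1 - p / 2) = (1 - p / 2) + -(2 - p) by ring, ENNReal.rpow_add _ _ hQ0 hQt]
        ring

theorem tsum_succ_le_tsum_block {m : ℕ → ℕ} (hm : ∀ k, 2 ≤ m k) (g : ℕ → ℝ≥0∞) :
    ∑' k : ℕ, g (k + 1) ≤ ∑' j : ℕ, ∑ k ∈ Finset.Ico (M m j) (M m (j + 1)), g k := by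
  refine ENNReal.tsum_le_of_sum_range_le fun n => ?_
  calc ∑ k ∈ Finset.range n, g (k + 1) = ∑ k ∈ Finset.Ico 1 (n + 1), g k := by
        rw [Finset.sum_Ico_eq_sum_range]
        simp [add_comm]
    _ ≤ ∑ k ∈ Finset.Ico (M m 0) (M m n), g k :=
        Finset.sum_le_sum_of_subset (Finset.Ico_subset_Ico le_rfl (lt_M hm n))
    _ = ∑ j ∈ Finset.range n, ∑ k ∈ Finset.Ico (M m j) (M m (j + 1)), g k := by
        induction n with
        | zero => simp
        | succ n ih =>
          rw [Finset.sum_range_succ, ← ih, Finset.sum_Ico_consecutive]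
          · exact M_mono hm (Nat.zero_le n)
          · exact M_mono hm n.le_succ
    _ ≤ _ := ENNReal.sum_le_tsum _

theorem tsum_coeff_le {m : ℕ → ℕ} (hm : ∀ k, 2 ≤ m k) {lam : ℕ} (hlam : ∀ k, m k ≤ lam)
    {p : ℝ} (hp0 : 0 < p) (hp1 : p ≤ 1) {μ : Measure (Gm m)} (hμ : IsHaar m μ)
    {f : ℕ → Gm m → ℂ} (hf : IsMartingale m μ f) :
    ∑' k : ℕ, ‖coeff m μ f (k + 1)‖ₑ ^ p / ((k + 1 : ℕ) : ℝ≥0∞) ^ (2 - p) ≤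
      (lam : ℝ≥0∞) ^ (2 - p) * (2 ^ p * geomConst (1 - p / 2) * geomConst p) *
        ∫⁻ x, mstar m f x ^ p ∂μ := by
  refine (tsum_succ_le_tsum_block hm
    fun k => ‖coeff m μ f k‖ₑ ^ p / (k : ℝ≥0∞) ^ (2 - p)).trans ?_
  refine (ENNReal.tsum_le_tsum fun j => sum_coeff_block_le hm hlam hp0 hp1 hμ hf j).trans ?_
  rw [ENNReal.tsum_mul_left, mul_assoc]
  gcongr
  refine le_trans ?_ (tsum_M_rpow_mul_lintegral_le hm hp0 hp1 hμ hf)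
  exact ENNReal.tsum_comp_le_tsum_of_injective (add_left_injective 1) fun j =>
    (M m j : ℝ≥0∞) ^ (-(1 - p / 2)) * (∫⁻ x, ‖f j x‖ₑ ^ (2 : ℝ) ∂μ) ^ (p / 2)

end Vilenkin

/-- Hardy-type inequality: for `0 < p ≤ 1` there is `c_p > 0`
(depending only on `p` and `λ = sup m_k`) with
`∑_{k=1}^∞ |f̂(k)|^p / k^{2-p} ≤ c_p ‖f‖_{H_p}^p` for every martingale `f ∈ H_p`. -/
theorem statement7 (p : ℝ) (hp0 : 0 < p) (hp1 : p ≤ 1) (lam : ℕ) :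
    ∃ c : ℝ, 0 < c ∧
      ∀ (m : ℕ → ℕ), (∀ k, 2 ≤ m k) → (∀ k, m k ≤ lam) →
      ∀ (μ : Measure (Gm m)), Vilenkin.IsHaar m μ →
      ∀ (f : ℕ → Gm m → ℂ), Vilenkin.IsMartingale m μ f → Vilenkin.MemHp m μ p f →
        ∑' k : ℕ, (‖Vilenkin.coeff m μ f (k + 1)‖₊ : ℝ≥0∞) ^ p /
            ((k + 1 : ℕ) : ℝ≥0∞) ^ (2 - p) ≤
          ENNReal.ofReal c * ∫⁻ x, Vilenkin.mstar m f x ^ p ∂μ := by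
  set C : ℝ≥0∞ := (lam : ℝ≥0∞) ^ (2 - p) *
    (2 ^ p * Vilenkin.geomConst (1 - p / 2) * Vilenkin.geomConst p) with hC
  have hCt : C ≠ ⊤ := by
    refine ENNReal.mul_ne_top (ENNReal.rpow_ne_top_of_nonneg (by linarith) (by simp))
      (ENNReal.mul_ne_top (ENNReal.mul_ne_top (ENNReal.rpow_ne_top_of_nonneg hp0.le (by simp)) ?_) ?_)
    · exact Vilenkin.geomConst_ne_top (by linarith)
    · exact Vilenkin.geomConst_ne_top hp0
  refine ⟨C.toReal + 1, by positivity, fun m hm hlam μ hμ f hf _ => ?_⟩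
  refine (Vilenkin.tsum_coeff_le hm hlam hp0 hp1 hμ hf).trans ?_
  rw [← hC]
  gcongr
  exact (ENNReal.ofReal_toReal hCt).symm.le.trans (ENNReal.ofReal_le_ofReal (by linarith))
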